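/- arXiv:1802.03517 — 2 statements merged into one kernel-verified Lean document; each statement's English description precedes it below -/
import Mathlib

section
/- Let D, m be positive integers with m < D. Let u ∈ ℝ^D be a unit vector and let B ∈ ℝ^{D×(D−m)} have orthonormal columns with Bᵀu = 0. On a probability space, let θ be a real-valued random variable with c := E[cos² θ], and let x be a random vector distributed uniformly on the unit sphere S^{D−m−1} ⊂ ℝ^{D−m}, with θ and x independent. Define the disturbed basis ũ = (cos θ) u + (sin θ) B x. Then E[ũ ũᵀ] = c · u uᵀ + ((1 − c)/(D − m)) · B Bᵀ, and c ∈ [0, 1]. -/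
open Matrix MeasureTheory ProbabilityTheory

section Isotropic

variable {Ω ι : Type*} [MeasurableSpace Ω] {μ : Measure Ω} [Fintype ι]
  {x : Ω → ι → ℝ}

lemma integrable_coord_of_unit_sphere [IsFiniteMeasure μ] (hx : Measurable x)
    (hsphere : ∀ᵐ ω ∂μ, ∑ l, x ω l ^ 2 = 1) (k : ι) : Integrable (fun ω => x ω k) μ := by
  refine .of_mem_Icc (-1) 1 (by fun_prop) ?_
  filter_upwards [hsphere] with ω h
  have hk : x ω k ^ 2 ≤ 1 :=
    h ▸ Finset.single_le_sum (f := fun l => x ω l ^ 2) (fun l _ => sq_nonneg _)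
      (Finset.mem_univ k)
  exact abs_le.1 ((sq_le_one_iff_abs_le_one _).1 hk)

lemma integrable_coord_mul_coord_of_unit_sphere [IsFiniteMeasure μ] (hx : Measurable x)
    (hsphere : ∀ᵐ ω ∂μ, ∑ l, x ω l ^ 2 = 1) (k l : ι) :
    Integrable (fun ω => x ω k * x ω l) μ := by
  refine (integrable_coord_of_unit_sphere hx hsphere l).bdd_mul (c := 1) (by fun_prop) ?_
  filter_upwards [hsphere] with ω h
  have hk : x ω k ^ 2 ≤ 1 :=
    h ▸ Finset.single_le_sum (f := fun l => x ω l ^ 2) (fun l _ => sq_nonneg _)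
      (Finset.mem_univ k)
  exact (sq_le_one_iff_abs_le_one _).1 hk

lemma mulVec_mul_mulVec_eq_sum {κ : Type*} (B : Matrix κ ι ℝ) (v : ι → ℝ) (i j : κ) :
    (B *ᵥ v) i * (B *ᵥ v) j = ∑ k, ∑ l, B i k * B j l * (v k * v l) := by
  simp only [mulVec, dotProduct, Finset.sum_mul_sum]
  exact Finset.sum_congr rfl fun k _ => Finset.sum_congr rfl fun l _ => by ring

lemma integrable_mulVec_mul_mulVec_of_unit_sphere {κ : Type*} [IsFiniteMeasure μ]
    (hx : Measurable x) (hsphere : ∀ᵐ ω ∂μ, ∑ l, x ω l ^ 2 = 1)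
    (B : Matrix κ ι ℝ) (i j : κ) : Integrable (fun ω => (B *ᵥ x ω) i * (B *ᵥ x ω) j) μ := by
  simp only [mulVec_mul_mulVec_eq_sum]
  exact integrable_finsetSum _ fun k _ => integrable_finsetSum _ fun l _ =>
    (integrable_coord_mul_coord_of_unit_sphere hx hsphere k l).const_mul _

variable [DecidableEq ι]

lemma integral_comp_mulVec_of_rotation_invariant (hx : Measurable x)
    (hrot : ∀ Q : Matrix ι ι ℝ, Qᵀ * Q = 1 → μ.map (fun ω => Q *ᵥ x ω) = μ.map x)
    {Q : Matrix ι ι ℝ} (hQ : Qᵀ * Q = 1) {f : (ι → ℝ) → ℝ} (hf : Continuous f) :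
    ∫ ω, f (Q *ᵥ x ω) ∂μ = ∫ ω, f (x ω) ∂μ := by
  have hQx : Measurable fun ω => Q *ᵥ x ω :=
    (Continuous.matrix_mulVec continuous_const continuous_id).measurable.comp hx
  rw [← integral_map_of_stronglyMeasurable hQx hf.stronglyMeasurable, hrot Q hQ,
    integral_map_of_stronglyMeasurable hx hf.stronglyMeasurable]

lemma integral_coord_eq_zero_of_rotation_invariant (hx : Measurable x)
    (hrot : ∀ Q : Matrix ι ι ℝ, Qᵀ * Q = 1 → μ.map (fun ω => Q *ᵥ x ω) = μ.map x) (k : ι) :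
    ∫ ω, x ω k ∂μ = 0 := by
  have h := integral_comp_mulVec_of_rotation_invariant hx hrot (Q := -1) (by simp)
    (continuous_apply k)
  simp only [neg_mulVec, one_mulVec, Pi.neg_apply, integral_neg] at h
  linarith

lemma integral_coord_mul_coord_eq_zero_of_rotation_invariant (hx : Measurable x)
    (hrot : ∀ Q : Matrix ι ι ℝ, Qᵀ * Q = 1 → μ.map (fun ω => Q *ᵥ x ω) = μ.map x)
    {k l : ι} (hkl : k ≠ l) : ∫ ω, x ω k * x ω l ∂μ = 0 := by
  have hQ : (diagonal fun i => if i = k then (-1 : ℝ) else 1)ᵀ *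
      diagonal (fun i => if i = k then (-1 : ℝ) else 1) = 1 := by
    rw [diagonal_transpose, diagonal_mul_diagonal, ← diagonal_one]
    congr 1
    ext i
    split_ifs <;> simp
  have h := integral_comp_mulVec_of_rotation_invariant hx hrot hQ
    ((continuous_apply k).mul (continuous_apply l))
  simp only [mulVec_diagonal, Pi.mul_apply, if_true, if_neg hkl.symm, neg_mul, one_mul,
    integral_neg] at h
  linarith

lemma integral_coord_sq_eq_of_rotation_invariant (hx : Measurable x)
    (hrot : ∀ Q : Matrix ι ι ℝ, Qᵀ * Q = 1 → μ.map (fun ω => Q *ᵥ x ω) = μ.map x)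
    (k l : ι) : ∫ ω, x ω k ^ 2 ∂μ = ∫ ω, x ω l ^ 2 ∂μ := by
  have hQ : ((Equiv.swap k l).permMatrix ℝ)ᵀ * (Equiv.swap k l).permMatrix ℝ = 1 := by
    rw [transpose_permMatrix, ← permMatrix_mul, mul_inv_cancel, permMatrix_one]
  have h := integral_comp_mulVec_of_rotation_invariant hx hrot hQ ((continuous_apply l).pow 2)
  simpa [permMatrix_mulVec] using h

/-- The second moment matrix of a uniform random vector on the unit sphere is `(1 / n) • 1`. -/
lemma integral_coord_mul_coord_of_uniform_sphere [IsProbabilityMeasure μ] (hx : Measurable x)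
    (hsphere : ∀ᵐ ω ∂μ, ∑ l, x ω l ^ 2 = 1)
    (hrot : ∀ Q : Matrix ι ι ℝ, Qᵀ * Q = 1 → μ.map (fun ω => Q *ᵥ x ω) = μ.map x)
    (k l : ι) : ∫ ω, x ω k * x ω l ∂μ = if k = l then (Fintype.card ι : ℝ)⁻¹ else 0 := by
  split_ifs with hkl
  · subst hkl
    have hsum : ∑ i, ∫ ω, x ω i ^ 2 ∂μ = 1 := by
      rw [← integral_finsetSum _ fun i _ => by
        simpa only [sq] using integrable_coord_mul_coord_of_unit_sphere hx hsphere i i,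
        integral_congr_ae hsphere]
      simp
    rw [Finset.sum_congr rfl fun i _ =>
      integral_coord_sq_eq_of_rotation_invariant hx hrot i k] at hsum
    simp only [Finset.sum_const, Finset.card_univ, nsmul_eq_mul] at hsum
    simpa only [sq] using eq_inv_of_mul_eq_one_right hsum
  · exact integral_coord_mul_coord_eq_zero_of_rotation_invariant hx hrot hkl

lemma integral_mulVec_eq_zero_of_uniform_sphere {κ : Type*} [IsProbabilityMeasure μ]
    (hx : Measurable x) (hsphere : ∀ᵐ ω ∂μ, ∑ l, x ω l ^ 2 = 1)
    (hrot : ∀ Q : Matrix ι ι ℝ, Qᵀ * Q = 1 → μ.map (fun ω => Q *ᵥ x ω) = μ.map x)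
    (B : Matrix κ ι ℝ) (i : κ) : ∫ ω, (B *ᵥ x ω) i ∂μ = 0 := by
  simp only [mulVec, dotProduct]
  rw [integral_finsetSum _ fun k _ =>
    (integrable_coord_of_unit_sphere hx hsphere k).const_mul _]
  simp [integral_const_mul, integral_coord_eq_zero_of_rotation_invariant hx hrot]

lemma integral_mulVec_mul_mulVec_of_uniform_sphere {κ : Type*} [IsProbabilityMeasure μ]
    (hx : Measurable x) (hsphere : ∀ᵐ ω ∂μ, ∑ l, x ω l ^ 2 = 1)
    (hrot : ∀ Q : Matrix ι ι ℝ, Qᵀ * Q = 1 → μ.map (fun ω => Q *ᵥ x ω) = μ.map x)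
    (B : Matrix κ ι ℝ) (i j : κ) :
    ∫ ω, (B *ᵥ x ω) i * (B *ᵥ x ω) j ∂μ = (Fintype.card ι : ℝ)⁻¹ * (B * Bᵀ) i j := by
  have hint (k l : ι) : Integrable (fun ω => B i k * B j l * (x ω k * x ω l)) μ :=
    (integrable_coord_mul_coord_of_unit_sphere hx hsphere k l).const_mul _
  simp only [mulVec_mul_mulVec_eq_sum]
  rw [integral_finsetSum _ fun k _ => integrable_finsetSum _ fun l _ => hint k l, mul_apply,
    Finset.mul_sum]
  refine Finset.sum_congr rfl fun k _ => ?_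
  rw [integral_finsetSum _ fun l _ => hint k l]
  simp only [integral_const_mul, integral_coord_mul_coord_of_uniform_sphere hx hsphere hrot]
  simp [mul_comm]

end Isotropic

/-- Lemma 4 (pseudo-Gaussian disturbance): let `u ∈ ℝ^D` be a unit vector, `B` a
`D × (D-m)` matrix with orthonormal columns orthogonal to `u`, `θ` a real random
variable with `c = E[cos² θ]`, and `x` an independent random direction distributed
uniformly on the unit sphere of `ℝ^{D-m}` (its law is concentrated on the sphere and
rotation invariant).  Then the disturbed basis `ũ = (cos θ) u + (sin θ) B x` satisfies
`E[ũ ũᵀ] = c · u uᵀ + ((1 - c)/(D - m)) · B Bᵀ`, and `c ∈ [0, 1]`. -/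
theorem pseudo_gaussian_disturbance_expectation (D m : ℕ) (hm : 0 < m) (hmD : m < D)
    (u : Fin D → ℝ) (hu : ∑ i, u i ^ 2 = 1)
    (B : Matrix (Fin D) (Fin (D - m)) ℝ) (hB : Bᵀ * B = 1)
    (hBu : Bᵀ.mulVec u = 0)
    {Ω : Type*} [MeasureSpace Ω] [IsProbabilityMeasure (ℙ : Measure Ω)]
    (θ : Ω → ℝ) (hθ : Measurable θ)
    (x : Ω → Fin (D - m) → ℝ) (hx : Measurable x)
    (hxsphere : ∀ᵐ ω, ∑ l, x ω l ^ 2 = 1)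
    (hxrot : ∀ Q : Matrix (Fin (D - m)) (Fin (D - m)) ℝ, Qᵀ * Q = 1 →
      Measure.map (fun ω => Q.mulVec (x ω)) ℙ = Measure.map x ℙ)
    (hindep : IndepFun θ x)
    (c : ℝ) (hc : c = ∫ ω, Real.cos (θ ω) ^ 2) :
    (∀ i j : Fin D,
      ∫ ω, (Real.cos (θ ω) * u i + Real.sin (θ ω) * B.mulVec (x ω) i) *
            (Real.cos (θ ω) * u j + Real.sin (θ ω) * B.mulVec (x ω) j)
        = c * (u i * u j) + (1 - c) / ((D : ℝ) - m) * (B * Bᵀ) i j)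
    ∧ 0 ≤ c ∧ c ≤ 1 := by
  have hn : (Fintype.card (Fin (D - m)) : ℝ) = D - m := by
    rw [Fintype.card_fin, Nat.cast_sub hmD.le]
  have hcos : Integrable (fun ω => Real.cos (θ ω) ^ 2) :=
    .of_mem_Icc 0 1 (by fun_prop) (.of_forall fun ω => ⟨sq_nonneg _, Real.cos_sq_le_one _⟩)
  have hsin : Integrable (fun ω => Real.sin (θ ω) ^ 2) :=
    .of_mem_Icc 0 1 (by fun_prop) (.of_forall fun ω => ⟨sq_nonneg _, Real.sin_sq_le_one _⟩)
  have hcs : Integrable (fun ω => Real.cos (θ ω) * Real.sin (θ ω)) := by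
    refine .of_mem_Icc (-1) 1 (by fun_prop) (.of_forall fun ω => abs_le.1 ?_)
    rw [abs_mul]
    exact mul_le_one₀ (Real.abs_cos_le_one _) (abs_nonneg _) (Real.abs_sin_le_one _)
  have hsin_eq : ∫ ω, Real.sin (θ ω) ^ 2 = 1 - c := by
    simp only [Real.sin_sq]
    rw [integral_sub (integrable_const _) hcos, ← hc]
    simp
  refine ⟨fun i j => ?_, hc ▸ integral_nonneg fun ω => sq_nonneg _, ?_⟩
  · have hBc (i : Fin D) : Continuous fun v : Fin (D - m) → ℝ => (B *ᵥ v) i := by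
      simp only [mulVec, dotProduct]
      fun_prop
    have hBint (i : Fin D) : Integrable fun ω => (B *ᵥ x ω) i := by
      simp only [mulVec, dotProduct]
      exact integrable_finsetSum _ fun k _ =>
        (integrable_coord_of_unit_sphere hx hxsphere k).const_mul _
    have hcross_indep (i : Fin D) :
        IndepFun (fun ω => Real.cos (θ ω) * Real.sin (θ ω)) (fun ω => (B *ᵥ x ω) i) :=
      hindep.comp (φ := fun t => Real.cos t * Real.sin t) (by fun_prop) (hBc i).measurable
    have hquad_indep : IndepFun (fun ω => Real.sin (θ ω) ^ 2)
        (fun ω => (B *ᵥ x ω) i * (B *ᵥ x ω) j) :=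
      hindep.comp (φ := fun t => Real.sin t ^ 2) (by fun_prop)
        ((hBc i).mul (hBc j)).measurable
    have hquad_int := integrable_mulVec_mul_mulVec_of_unit_sphere hx hxsphere B i j
    have hcross (i : Fin D) :
        ∫ ω, Real.cos (θ ω) * Real.sin (θ ω) * (B *ᵥ x ω) i = 0 := by
      rw [(hcross_indep i).integral_fun_mul_eq_mul_integral hcs.1 (hBint i).1,
        integral_mulVec_eq_zero_of_uniform_sphere hx hxsphere hxrot, mul_zero]
    have hquad : ∫ ω, Real.sin (θ ω) ^ 2 * ((B *ᵥ x ω) i * (B *ᵥ x ω) j) =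
        (1 - c) / ((D : ℝ) - m) * (B * Bᵀ) i j := by
      rw [hquad_indep.integral_fun_mul_eq_mul_integral hsin.1 hquad_int.1, hsin_eq,
        integral_mulVec_mul_mulVec_of_uniform_sphere hx hxsphere hxrot, hn, div_eq_mul_inv,
        mul_assoc]
    have hcross_int (i : Fin D) :
        Integrable fun ω => Real.cos (θ ω) * Real.sin (θ ω) * (B *ᵥ x ω) i :=
      (hcross_indep i).integrable_mul hcs (hBint i)
    have hquad_int' :
        Integrable fun ω => Real.sin (θ ω) ^ 2 * ((B *ᵥ x ω) i * (B *ᵥ x ω) j) :=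
      hquad_indep.integrable_mul hsin hquad_int
    calc
      _ = ∫ ω, (Real.cos (θ ω) ^ 2 * (u i * u j) +
            (Real.cos (θ ω) * Real.sin (θ ω) * (B *ᵥ x ω) j * u i +
              Real.cos (θ ω) * Real.sin (θ ω) * (B *ᵥ x ω) i * u j)) +
            Real.sin (θ ω) ^ 2 * ((B *ᵥ x ω) i * (B *ᵥ x ω) j) := by
        congr 1
        ext ω
        ring
      _ = _ := by
        have hcross_sum_int : Integrable fun ω =>
            Real.cos (θ ω) * Real.sin (θ ω) * (B *ᵥ x ω) j * u i +
              Real.cos (θ ω) * Real.sin (θ ω) * (B *ᵥ x ω) i * u j :=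
          ((hcross_int j).mul_const (u i)).add ((hcross_int i).mul_const (u j))
        rw [integral_add (by exact (hcos.mul_const _).add hcross_sum_int) hquad_int',
          integral_add (hcos.mul_const _) hcross_sum_int,
          integral_add ((hcross_int j).mul_const _) ((hcross_int i).mul_const _), hquad]
        simp only [integral_mul_const, hcross, ← hc]
        ring
  · have : 0 ≤ ∫ ω, Real.sin (θ ω) ^ 2 := integral_nonneg fun ω => sq_nonneg _
    linarith
end

section
/- Let D, m be positive integers with m < D. For i = 1, 2 let U_i ∈ ℝ^{D×m} have orthonormal columns, let Σ_i be an m×m real diagonal matrix, set Δ_i = (m − tr Σ_i)/(D − m), and define A_i = U_i Σ_i U_iᵀ + Δ_i (I_D − U_i U_iᵀ). Then tr(A₁ A₂) = tr[(Σ₁ − Δ₁ I_m) U₁ᵀ U₂ (Σ₂ − Δ₂ I_m) U₂ᵀ U₁] + Δ₁ tr Σ₂ + Δ₂ tr Σ₁ + Δ₁ Δ₂ (D − 2m). -/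
open Matrix

/-- Spreading a multiple of the complementary projection over the whole space. -/
lemma conj_add_smul_one_sub_proj {n k R : Type*} [CommRing R] [Fintype k]
    [DecidableEq n] [DecidableEq k] (U : Matrix n k R) (S : Matrix k k R) (c : R) :
    U * S * Uᵀ + c • (1 - U * Uᵀ) = U * (S - c • (1 : Matrix k k R)) * Uᵀ + c • 1 := by
  simp only [Matrix.mul_sub, Matrix.sub_mul, Matrix.mul_smul, Matrix.smul_mul, Matrix.mul_one,
    smul_sub]
  abel

/-- Conjugating by a matrix with orthonormal columns preserves the trace. -/
lemma trace_conj_of_transpose_mul_self {n k R : Type*} [CommRing R] [Fintype n] [Fintype k]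
    [DecidableEq k] (U : Matrix n k R) (hU : Uᵀ * U = 1) (S : Matrix k k R) :
    Matrix.trace (U * S * Uᵀ) = Matrix.trace S := by
  rw [Matrix.trace_mul_cycle, hU, Matrix.one_mul]

/-- Closed form of the DG Pseudo-Gaussian kernel: for `i = 1, 2`, let `Uᵢ` have
orthonormal columns, `Σᵢ` be diagonal, `Δᵢ = (m - tr Σᵢ)/(D - m)` and
`Aᵢ = Uᵢ Σᵢ Uᵢᵀ + Δᵢ (I_D - Uᵢ Uᵢᵀ)` (the expected projection matrix under the
pseudo-Gaussian disturbance).  Then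
`tr(A₁ A₂) = tr[(Σ₁ - Δ₁ I) U₁ᵀ U₂ (Σ₂ - Δ₂ I) U₂ᵀ U₁] + Δ₁ tr Σ₂ + Δ₂ tr Σ₁ + Δ₁ Δ₂ (D - 2m)`. -/
theorem dg_pg_kernel_closed_form (D m : ℕ) (hm : 0 < m) (hmD : m < D)
    (U₁ U₂ : Matrix (Fin D) (Fin m) ℝ)
    (hU₁ : U₁ᵀ * U₁ = 1) (hU₂ : U₂ᵀ * U₂ = 1)
    (σ₁ σ₂ : Fin m → ℝ) (Δ₁ Δ₂ : ℝ)
    (hΔ₁ : Δ₁ = ((m : ℝ) - Matrix.trace (Matrix.diagonal σ₁)) / ((D : ℝ) - m))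
    (hΔ₂ : Δ₂ = ((m : ℝ) - Matrix.trace (Matrix.diagonal σ₂)) / ((D : ℝ) - m))
    (A₁ A₂ : Matrix (Fin D) (Fin D) ℝ)
    (hA₁ : A₁ = U₁ * Matrix.diagonal σ₁ * U₁ᵀ + Δ₁ • (1 - U₁ * U₁ᵀ))
    (hA₂ : A₂ = U₂ * Matrix.diagonal σ₂ * U₂ᵀ + Δ₂ • (1 - U₂ * U₂ᵀ)) :
    Matrix.trace (A₁ * A₂)
      = Matrix.trace ((Matrix.diagonal σ₁ - Δ₁ • (1 : Matrix (Fin m) (Fin m) ℝ)) *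
            (U₁ᵀ * U₂) * (Matrix.diagonal σ₂ - Δ₂ • (1 : Matrix (Fin m) (Fin m) ℝ)) *
            (U₂ᵀ * U₁))
        + Δ₁ * Matrix.trace (Matrix.diagonal σ₂)
        + Δ₂ * Matrix.trace (Matrix.diagonal σ₁)
        + Δ₁ * Δ₂ * ((D : ℝ) - 2 * m) := by
  have hcross (S T : Matrix (Fin m) (Fin m) ℝ) :
      Matrix.trace (U₁ * S * U₁ᵀ * (U₂ * T * U₂ᵀ))
        = Matrix.trace (S * (U₁ᵀ * U₂) * T * (U₂ᵀ * U₁)) := by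
    simp only [Matrix.mul_assoc]
    rw [Matrix.trace_mul_comm U₁]
    simp only [Matrix.mul_assoc]
  rw [hA₁, hA₂, conj_add_smul_one_sub_proj, conj_add_smul_one_sub_proj, Matrix.add_mul,
    Matrix.mul_add, Matrix.trace_add, Matrix.trace_add, hcross]
  simp only [Matrix.mul_smul, Matrix.smul_mul, Matrix.mul_one, Matrix.one_mul, Matrix.mul_add,
    Matrix.trace_add, Matrix.trace_smul, trace_conj_of_transpose_mul_self _ hU₁,
    trace_conj_of_transpose_mul_self _ hU₂]
  simp only [Matrix.trace_sub (Matrix.diagonal _), Matrix.trace_smul, Matrix.trace_one,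
    Fintype.card_fin, smul_eq_mul]
  ring
end
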